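/- Let k = 2^i − 1 be a Mersenne prime with i ≥ 2. Then the minimal binary Niven number is exactly a_k = 2^{k+i−1} + 2^k − 2^{k−i} − 1. -/

import Mathlib

/-- `binDigitSum n` is the sum of the binary digits of `n`. -/
def binDigitSum (n : ℕ) : ℕ := (Nat.digits 2 n).sum

theorem binDigitSum_zero : binDigitSum 0 = 0 := by simp [binDigitSum]

theorem binDigitSum_eq_mod_add_div (n : ℕ) : binDigitSum n = n % 2 + binDigitSum (n / 2) := by
  rcases Nat.eq_zero_or_pos n with rfl | h
  · simp [binDigitSum]
  · simp [binDigitSum, Nat.digits_def' one_lt_two h]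

theorem binDigitSum_add_le (a b : ℕ) :
    binDigitSum (a + b) ≤ binDigitSum a + binDigitSum b := by
  have succ_le : ∀ n, binDigitSum (n + 1) ≤ binDigitSum n + 1 := by
    intro n
    induction n using Nat.strong_induction_on with
    | _ n ih =>
      rw [binDigitSum_eq_mod_add_div (n + 1), binDigitSum_eq_mod_add_div n]
      rcases Nat.mod_two_eq_zero_or_one n with h | h
      · rw [show (n + 1) / 2 = n / 2 by omega]
        omega
      · have := ih (n / 2) (by omega)
        rw [show (n + 1) / 2 = n / 2 + 1 by omega]
        omega
  induction a using Nat.strong_induction_on generalizing b with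
  | _ a ih =>
    rcases Nat.eq_zero_or_pos a with rfl | ha
    · simp
    rw [binDigitSum_eq_mod_add_div (a + b), binDigitSum_eq_mod_add_div a,
      binDigitSum_eq_mod_add_div b]
    have h := ih (a / 2) (by omega) (b / 2)
    by_cases hc : a % 2 + b % 2 = 2
    · rw [show (a + b) / 2 = a / 2 + b / 2 + 1 by omega]
      have := succ_le (a / 2 + b / 2)
      omega
    · rw [show (a + b) / 2 = a / 2 + b / 2 by omega]
      omega

theorem binDigitSum_two_pow_mul_add (n q r : ℕ) (hr : r < 2 ^ n) :
    binDigitSum (2 ^ n * q + r) = binDigitSum q + binDigitSum r := by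
  induction n generalizing r with
  | zero =>
    obtain rfl : r = 0 := by simpa using hr
    simp [binDigitSum_zero]
  | succ n ih =>
    rw [pow_succ] at hr
    have e : 2 ^ (n + 1) * q + r = 2 * (2 ^ n * q) + r := by ring
    have h := ih (r / 2) (by omega)
    rw [e, binDigitSum_eq_mod_add_div (2 * (2 ^ n * q) + r), binDigitSum_eq_mod_add_div r,
      show (2 * (2 ^ n * q) + r) / 2 = 2 ^ n * q + r / 2 by omega, h]
    omega

theorem binDigitSum_add_of_add_succ_eq_two_pow {n x y : ℕ} (h : x + y + 1 = 2 ^ n) :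
    binDigitSum x + binDigitSum y = n := by
  induction n generalizing x y with
  | zero =>
    obtain ⟨rfl, rfl⟩ : x = 0 ∧ y = 0 := by
      rw [pow_zero] at h
      omega
    simp [binDigitSum_zero]
  | succ n ih =>
    rw [pow_succ] at h
    have := ih (x := x / 2) (y := y / 2) (by omega)
    rw [binDigitSum_eq_mod_add_div x, binDigitSum_eq_mod_add_div y]
    omega

theorem binDigitSum_pos {n : ℕ} (hn : 0 < n) : 0 < binDigitSum n := by
  induction n using Nat.strong_induction_on with
  | _ n ih =>
    rw [binDigitSum_eq_mod_add_div]
    by_cases h : n % 2 = 1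
    · omega
    · have := ih (n / 2) (by omega) (by omega)
      omega

theorem exists_eq_two_pow_of_binDigitSum_eq_one {n : ℕ} (h : binDigitSum n = 1) :
    ∃ z, n = 2 ^ z := by
  induction n using Nat.strong_induction_on with
  | _ n ih =>
    rcases Nat.eq_zero_or_pos n with rfl | hn
    · simp [binDigitSum_zero] at h
    rw [binDigitSum_eq_mod_add_div] at h
    rcases Nat.mod_two_eq_zero_or_one n with h0 | h1
    · obtain ⟨z, hz⟩ := ih (n / 2) (by omega) (by omega)
      exact ⟨z + 1, by rw [pow_succ]; omega⟩
    · rcases Nat.eq_zero_or_pos (n / 2) with h2 | h2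
      · exact ⟨0, by rw [pow_zero]; omega⟩
      · have := binDigitSum_pos h2
        omega

theorem binDigitSum_two_pow (z : ℕ) : binDigitSum (2 ^ z) = 1 := by
  have h := binDigitSum_two_pow_mul_add z 1 0 (by positivity)
  simpa [binDigitSum] using h

theorem le_binDigitSum_of_two_pow_sub_one_dvd {i m : ℕ} (hm : 0 < m) (h : 2 ^ i - 1 ∣ m) :
    i ≤ binDigitSum m := by
  induction m using Nat.strong_induction_on with
  | _ m ih =>
    rcases Nat.eq_zero_or_pos i with rfl | hi
    · exact Nat.zero_le _
    have hP : 2 ≤ 2 ^ i := Nat.le_self_pow hi.ne' 2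
    by_cases hlt : m < 2 ^ i
    · have := Nat.le_of_dvd hm h
      have hs := binDigitSum_add_of_add_succ_eq_two_pow (n := i) (x := 0) (y := m) (by omega)
      rw [binDigitSum_zero] at hs
      omega
    · have hdm := Nat.div_add_mod m (2 ^ i)
      have hr := Nat.mod_lt m (show 2 ^ i > 0 by omega)
      set q := m / 2 ^ i with hq
      set r := m % 2 ^ i
      have hqpos : 0 < q := Nat.div_pos (by omega) (by omega)
      have e : (2 ^ i - 1) * q + (q + r) = m := by
        rw [Nat.sub_mul, one_mul]
        have : q ≤ 2 ^ i * q := Nat.le_mul_of_pos_left _ (by omega)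
        omega
      have hlt' : 0 < (2 ^ i - 1) * q := Nat.mul_pos (by omega) hqpos
      have hd : 2 ^ i - 1 ∣ q + r := (Nat.dvd_add_right (dvd_mul_right _ q)).1 (e ▸ h)
      have h1 := ih (q + r) (by omega) (by omega) hd
      have h2 := binDigitSum_add_le q r
      have h3 := binDigitSum_two_pow_mul_add i q r hr
      rw [hdm] at h3
      omega

theorem exists_two_pow_sub_one_eq_mul_add_one {i : ℕ} (hi : 2 ≤ i) (hp : (2 ^ i - 1).Prime) :
    ∃ q, 2 ^ i - 1 = i * (q + 1) + 1 := by
  have hip : i.Prime := (Nat.prime_of_pow_sub_one_prime (by omega) hp).2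
  have := Fact.mk hip
  have hmod : 2 ≡ 2 ^ i [MOD i] := by
    rw [← ZMod.natCast_eq_natCast_iff]
    push_cast
    exact (ZMod.pow_card (2 : ZMod i)).symm
  have h4 : 2 ^ 2 ≤ 2 ^ i := Nat.pow_le_pow_right (by omega) hi
  obtain ⟨c, hc⟩ := (Nat.modEq_iff_dvd' (by omega)).1 hmod
  rcases c with _ | q
  · omega
  · exact ⟨q, by omega⟩

/-- If `k = 2^i - 1` is a Mersenne prime with `i ≥ 2`, then the minimal binary
Niven number (the smallest positive multiple of `k` with binary digit sum `k`)
is exactly `a_k = 2^(k+i-1) + 2^k - 2^(k-i) - 1`. -/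
theorem ak_eq_of_mersenne_prime
    (i k : ℕ) (hi : 2 ≤ i) (hk : k = 2 ^ i - 1) (hp : Nat.Prime k)
    (a : ℕ) (ha : IsLeast {N : ℕ | 0 < N ∧ k ∣ N ∧ binDigitSum N = k} a) :
    a = 2 ^ (k + i - 1) + 2 ^ k - 2 ^ (k - i) - 1 := by
  obtain ⟨q, hq⟩ := exists_two_pow_sub_one_eq_mul_add_one hi (hk ▸ hp)
  rw [← hk] at hq
  have hmul : i * (q + 1) = i * q + i := by ring
  have hPk : 2 ^ i = k + 1 := by
    have : 0 < 2 ^ i := by positivity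
    omega
  have hone : (2 : ZMod k) ^ i = 1 := by
    have := congrArg (Nat.cast : ℕ → ZMod k) hPk
    simpa using this
  have hpow : ∀ m t, (2 : ZMod k) ^ (i * m + t) = 2 ^ t := fun m t => by
    rw [pow_add, pow_mul, hone, one_pow, one_mul]
  have hT : (2 : ZMod k) ^ (k + i - 1) = 1 := by
    rw [show k + i - 1 = i * (q + 2) + 0 by rw [hq]; ring_nf; omega, hpow, pow_zero]
  have hK : (2 : ZMod k) ^ k = 2 := by
    rw [show (2 : ZMod k) ^ k = 2 ^ (i * (q + 1) + 1) by rw [← hq], hpow, pow_one]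
  have hki : k - i = i * q + 1 := by omega
  have hKi : (2 : ZMod k) ^ (k - i) = 2 := by rw [hki, hpow, pow_one]
  have hpos : 1 ≤ 2 ^ (k - i) := Nat.one_le_two_pow
  have hlt1 : 2 ^ (k - i) < 2 ^ k := Nat.pow_lt_pow_right one_lt_two (by omega)
  have hlt2 : 2 ^ k < 2 ^ (k + i - 1) := Nat.pow_lt_pow_right one_lt_two (by omega)
  have split : ∀ M, M < 2 ^ (k + i - 1) →
      binDigitSum (2 ^ (k + i - 1) + M) = 1 + binDigitSum M := fun M hM => by
    have := binDigitSum_two_pow_mul_add (k + i - 1) 1 M hM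
    rwa [mul_one, ← pow_zero 2, binDigitSum_two_pow] at this
  refine ha.unique ⟨⟨by omega, ?_, ?_⟩, ?_⟩
  · rw [← ZMod.natCast_eq_zero_iff]
    have e : 2 ^ (k + i - 1) + 2 ^ k - 2 ^ (k - i) - 1 + (2 ^ (k - i) + 1) =
      2 ^ (k + i - 1) + 2 ^ k := by omega
    have := congrArg (Nat.cast : ℕ → ZMod k) e
    rw [Nat.cast_add] at this
    push_cast at this
    rw [hT, hK, hKi] at this
    linear_combination this
  · have e : 2 ^ (k + i - 1) + 2 ^ k - 2 ^ (k - i) - 1 =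
      2 ^ (k + i - 1) + (2 ^ k - 2 ^ (k - i) - 1) := by omega
    have h := binDigitSum_add_of_add_succ_eq_two_pow (n := k) (x := 2 ^ k - 2 ^ (k - i) - 1)
      (y := 2 ^ (k - i)) (by omega)
    rw [binDigitSum_two_pow] at h
    rw [e, split _ (by omega)]
    omega
  · rintro N ⟨-, hdvd, hsum⟩
    by_contra! hN
    rw [← ZMod.natCast_eq_zero_iff] at hdvd
    rcases lt_or_ge N (2 ^ (k + i - 1)) with hsmall | hbig
    · obtain ⟨C, hC⟩ : ∃ C, N + C + 1 = 2 ^ (k + i - 1) :=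
        ⟨2 ^ (k + i - 1) - N - 1, by omega⟩
      have hs := binDigitSum_add_of_add_succ_eq_two_pow hC
      have hCpos : 0 < C := by
        rcases Nat.eq_zero_or_pos C with rfl | h
        · rw [binDigitSum_zero] at hs
          omega
        · exact h
      have hCd : k ∣ C := by
        rw [← ZMod.natCast_eq_zero_iff]
        have := congrArg (Nat.cast : ℕ → ZMod k) hC
        push_cast at this
        rw [hT, hdvd] at this
        linear_combination this
      have := le_binDigitSum_of_two_pow_sub_one_dvd hCpos (hk ▸ hCd)
      omega
    · obtain ⟨M, rfl⟩ := Nat.exists_eq_add_of_le hbig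
      rw [split M (by omega)] at hsum
      obtain ⟨D, hD⟩ : ∃ D, M + D + 1 = 2 ^ k := ⟨2 ^ k - M - 1, by omega⟩
      have hs := binDigitSum_add_of_add_succ_eq_two_pow hD
      obtain ⟨z, rfl⟩ := exists_eq_two_pow_of_binDigitSum_eq_one (n := D) (by omega)
      have hz1 : k - i < z := (Nat.pow_lt_pow_iff_right one_lt_two).1 (by omega)
      have hz2 : z < k := (Nat.pow_lt_pow_iff_right one_lt_two).1 (show 2 ^ z < 2 ^ k by omega)
      obtain ⟨t, rfl⟩ := Nat.exists_eq_add_of_lt hz1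
      have hzt : k - i + t + 1 = i * q + (t + 2) := by omega
      have hDc := congrArg (Nat.cast : ℕ → ZMod k) hD
      push_cast at hDc hdvd
      rw [hzt, hpow, hK] at hDc
      rw [hT] at hdvd
      have h2 : ((2 * (2 ^ (t + 1) - 1) : ℕ) : ZMod k) = 0 := by
        rw [Nat.cast_mul, Nat.cast_sub Nat.one_le_two_pow]
        push_cast
        linear_combination hDc - hdvd
      rw [ZMod.natCast_eq_zero_iff] at h2
      have hlt : 2 ^ (t + 1) < 2 ^ i := Nat.pow_lt_pow_right one_lt_two (by omega)
      have hge : 2 ^ 1 ≤ 2 ^ (t + 1) := Nat.pow_le_pow_right (by omega) (by omega)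
      rcases hp.dvd_mul.1 h2 with h | h
      · have := Nat.le_of_dvd (by omega) h
        have : i ≤ i * (q + 1) := Nat.le_mul_of_pos_right _ (by omega)
        omega
      · have := Nat.le_of_dvd (by omega) h
        omega
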